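/- Konvalinka–Lauve's Lemma 5 (Hall–Littlewood case): for all partitions λ, ν, Σ_μ (−t)^{|λ|−|μ|} vs_{λ/μ}(t) sk_{μ/ν}(t) = hs_{λ/ν}(t), where the sum is over all partitions μ with ν ⊆ μ ⊆ λ. -/

import Mathlib

/-!
Common framework: integer partitions, Gaussian binomials, Hall--Littlewood
Pieri coefficients, the ring of symmetric functions realized as polynomials
in the power sums, the Macdonald `(q,t)`-inner product, a characterisation
of the Macdonald polynomials `P_λ(X;q,t)`, skew Macdonald polynomials,
plethystic evaluations and the various Pieri coefficients of
Konvalinka--Lauve and Warnaar.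
-/

open scoped BigOperators

noncomputable section

namespace SkewPieriFormalization

/-- An integer partition, encoded as a finitely supported weakly decreasing
sequence of natural numbers; `part j` is the part `λ_{j+1}` (0-indexed). -/
structure Partition where
  part : ℕ →₀ ℕ
  antitone' : ∀ ⦃i j : ℕ⦄, i ≤ j → part j ≤ part i

namespace Partition

/-- Containment of Young diagrams: `μ ≤ λ` iff `μ_i ≤ λ_i` for all `i`. -/
instance : LE Partition := ⟨fun mu lam => ∀ j : ℕ, mu.part j ≤ lam.part j⟩

/-- `|λ|`, the size (sum of the parts). -/
def size (lam : Partition) : ℕ := lam.part.sum fun _ k => k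

/-- `l(λ)`, the number of (nonzero) parts. -/
def length (lam : Partition) : ℕ := lam.part.support.card

/-- `n(λ) = ∑_{i ≥ 1} (i-1) λ_i`. -/
def nstat (lam : Partition) : ℕ := lam.part.sum fun j k => j * k

/-- the `i`-th part `λ_i` (1-indexed). -/
def row (lam : Partition) (i : ℕ) : ℕ := lam.part (i - 1)

/-- the part `λ'_i = #{j : λ_j ≥ i}` of the conjugate partition (for `i ≥ 1`). -/
def conj (lam : Partition) (i : ℕ) : ℕ :=
  (lam.part.support.filter fun j => i ≤ lam.part j).card

/-- the multiplicity `m_r(λ)` of `r` as a part of `λ`. -/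
def mult (lam : Partition) (r : ℕ) : ℕ :=
  (lam.part.support.filter fun j => lam.part j = r).card

/-- `z_λ = ∏_{r ≥ 1} r^{m_r} m_r!`. -/
def zee (lam : Partition) : ℕ :=
  ∏ r ∈ Finset.Icc 1 (lam.part 0), r ^ lam.mult r * Nat.factorial (lam.mult r)

/-- the partial sum `λ_1 + ⋯ + λ_k`. -/
def psum (lam : Partition) (k : ℕ) : ℕ := ∑ j ∈ Finset.range k, lam.part j

/-- dominance order: `λ ⊵ μ` (for `|λ| = |μ|`). -/
def Dominates (lam mu : Partition) : Prop :=
  mu.size = lam.size ∧ ∀ k : ℕ, mu.psum k ≤ lam.psum k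

/-- the one-row partition `(r)`. -/
def single (r : ℕ) : Partition where
  part := Finsupp.single 0 r
  antitone' := by
    intro i j hij
    by_cases hj : j = 0
    · have : i = 0 := by omega
      simp [hj, this]
    · simp only [Finsupp.single_apply]
      split <;> split <;> omega

/-- the one-column partition `(1^m)`. -/
def column (m : ℕ) : Partition where
  part := Finsupp.onFinset (Finset.range m) (fun j => if j < m then 1 else 0)
    (fun j h => by
      simp only [Finset.mem_range]
      by_contra hc
      simp [hc] at h)
  antitone' := by
    intro i j hij
    simp only [Finsupp.onFinset_apply]
    split <;> split <;> omega

end Partition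

variable {F : Type*} [Field F]

/-- the `t`-integer `[n]_t = 1 + t + ⋯ + t^{n-1}`. -/
def qint (t : F) (n : ℕ) : F := ∑ j ∈ Finset.range n, t ^ j

/-- the `t`-factorial. -/
def qfac (t : F) (n : ℕ) : F := ∏ j ∈ Finset.range n, qint t (j + 1)

/-- the Gaussian binomial coefficient `[n choose k]_t`; it vanishes
unless `0 ≤ k ≤ n`. -/
def qbinom (t : F) (n k : ℤ) : F :=
  if 0 ≤ k ∧ k ≤ n then qfac t n.toNat / (qfac t k.toNat * qfac t (n - k).toNat) else 0

/-- the Hall--Littlewood Pieri coefficient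
`ψ'_{λ/μ}(t) = ∏_{i ≥ 1} [λ'_i - λ'_{i+1} choose λ'_i - μ'_i]_t`;
it vanishes unless `μ ⊆ λ` with `λ - μ` a vertical strip. -/
def vsHL (t : F) (lam mu : Partition) : F :=
  ∏ i ∈ Finset.Icc 1 (lam.part 0 + mu.part 0),
    qbinom t ((lam.conj i : ℤ) - lam.conj (i + 1)) ((lam.conj i : ℤ) - mu.conj i)

open Classical in
/-- the Hall--Littlewood Pieri coefficient `φ_{λ/μ}(t)`, equal to
`∏ (1 - t^{λ'_i - λ'_{i+1}})` over those `i ≥ 1` with `λ'_i = μ'_i + 1` and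
`λ'_{i+1} = μ'_{i+1}`, when `μ ⊆ λ` with `λ - μ` a horizontal strip, and
vanishing otherwise. -/
def hsHL (t : F) (lam mu : Partition) : F :=
  if ∀ i : ℕ, mu.conj i ≤ lam.conj i ∧ lam.conj i ≤ mu.conj i + 1 then
    ∏ i ∈ Finset.Icc 1 (lam.part 0 + mu.part 0),
      if lam.conj i = mu.conj i + 1 ∧ lam.conj (i + 1) = mu.conj (i + 1) then
        1 - t ^ (lam.conj i - lam.conj (i + 1))
      else 1
  else 0

/-- `n(λ/μ) = ∑_{i ≥ 1} C(λ'_i - μ'_i, 2)`. -/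
def nskew (lam mu : Partition) : ℕ :=
  ∑ i ∈ Finset.Icc 1 (lam.part 0 + mu.part 0), Nat.choose (lam.conj i - mu.conj i) 2

/-- the Konvalinka--Lauve coefficient
`sk_{λ/μ}(t) = t^{n(λ/μ)} ∏_{i ≥ 1} [λ'_i - μ'_{i+1} choose λ'_i - μ'_i]_t`;
it vanishes unless `μ ⊆ λ`. -/
def skHL (t : F) (lam mu : Partition) : F :=
  t ^ nskew lam mu *
    ∏ i ∈ Finset.Icc 1 (lam.part 0 + mu.part 0),
      qbinom t ((lam.conj i : ℤ) - mu.conj (i + 1)) ((lam.conj i : ℤ) - mu.conj i)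

/-- The ring of symmetric functions over `F`, realized as the polynomial ring
in the power sums: the variable `n` is the power sum `p_{n+1}`. -/
abbrev Sym (F : Type*) [Field F] := MvPolynomial ℕ F

/-- the power sum product `p_λ = p_{λ_1} p_{λ_2} ⋯`. -/
def pprod (lam : Partition) : Sym F :=
  ∏ j ∈ lam.part.support, MvPolynomial.X (lam.part j - 1)

/-- Macdonald's `(q,t)`-deformation of the Hall inner product, for which the
power sums are orthogonal with `⟨p_λ, p_λ⟩ = z_λ ∏_i (1-q^{λ_i})/(1-t^{λ_i})`. -/
def innerQT (q t : F) (f g : Sym F) : F :=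
  ∑ d ∈ f.support,
    f.coeff d * g.coeff d *
      d.prod fun n m =>
        (((n : F) + 1) ^ m * (Nat.factorial m : F)) *
          ((1 - q ^ (n + 1)) / (1 - t ^ (n + 1))) ^ m

/-- the complete homogeneous symmetric function `h_r = ∑_{|κ| = r} z_κ⁻¹ p_κ`. -/
def hsym (F : Type*) [Field F] (r : ℕ) : Sym F :=
  ∑ᶠ (k : Partition) (_ : k.size = r), ((k.zee : F))⁻¹ • (pprod k : Sym F)

/-- the elementary symmetric function `e_r = ∑_{|κ| = r} (-1)^{r - l(κ)} z_κ⁻¹ p_κ`. -/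
def esym (F : Type*) [Field F] (r : ℕ) : Sym F :=
  ∑ᶠ (k : Partition) (_ : k.size = r),
    ((-1 : F) ^ (r - k.length) * (k.zee : F)⁻¹) • (pprod k : Sym F)

/-- `h_μ = h_{μ_1} h_{μ_2} ⋯`. -/
def hprod (F : Type*) [Field F] (mu : Partition) : Sym F :=
  ∏ j ∈ mu.part.support, hsym F (mu.part j)

/-- Characterisation of the (monic) Macdonald polynomial family
`λ ↦ P_λ(X;q,t)`: the `P_λ` are pairwise orthogonal for the `(q,t)`-inner
product, and `P_λ = m_λ + ∑_{μ ⊲ λ} u_{λμ} m_μ` is unitriangular with respect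
to dominance order in the monomial basis.  Since `{h_μ}` is the dual basis of
`{m_μ}` for the classical Hall pairing (the case `q = t`), unitriangularity is
expressed by the last two conditions.  For `q = 0` this characterises the
Hall--Littlewood polynomials `P_λ(X;t)`. -/
def IsMacdonald (q t : F) (P : Partition → Sym F) : Prop :=
  (∀ lam mu, lam ≠ mu → innerQT q t (P lam) (P mu) = 0) ∧
  (∀ lam, innerQT t t (P lam) (hprod F lam) = 1) ∧
  (∀ lam mu, ¬ Partition.Dominates lam mu → innerQT t t (P lam) (hprod F mu) = 0)

/-- `b_λ = ⟨P_λ, P_λ⟩⁻¹`. -/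
def bnorm (q t : F) (P : Partition → Sym F) (lam : Partition) : F :=
  (innerQT q t (P lam) (P lam))⁻¹

/-- `Q_λ = b_λ P_λ`. -/
def macQ (q t : F) (P : Partition → Sym F) (lam : Partition) : Sym F :=
  bnorm q t P lam • P lam

/-- the skew Macdonald polynomial `Q_{λ/μ}`, defined by
`⟨Q_{λ/μ}, P_ν⟩ = ⟨Q_λ, P_μ P_ν⟩`. -/
def skewQ (q t : F) (P : Partition → Sym F) (lam mu : Partition) : Sym F :=
  ∑ᶠ nu : Partition, innerQT q t (macQ q t P lam) (P mu * P nu) • macQ q t P nu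

/-- the skew Macdonald polynomial `P_{λ/μ}`, defined by
`⟨P_{λ/μ}, Q_ν⟩ = ⟨P_λ, Q_μ Q_ν⟩`. -/
def skewP (q t : F) (P : Partition → Sym F) (lam mu : Partition) : Sym F :=
  ∑ᶠ nu : Partition, innerQT q t (P lam) (macQ q t P mu * macQ q t P nu) • P nu

/-- the Littlewood--Richardson coefficient `f_{μν}^λ(q,t) = ⟨Q_λ, P_μ P_ν⟩`,
so that `P_μ P_ν = ∑_λ f_{μν}^λ P_λ`. -/
def lr (q t : F) (P : Partition → Sym F) (mu nu lam : Partition) : F :=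
  innerQT q t (macQ q t P lam) (P mu * P nu)

/-- the plethystic evaluation `f ↦ f((a-b)/(1-t))`, determined on power sums
by `p_r ↦ (a^r - b^r)/(1 - t^r)`. -/
def plethAB (t a b : F) (f : Sym F) : F :=
  MvPolynomial.eval (fun n => (a ^ (n + 1) - b ^ (n + 1)) / (1 - t ^ (n + 1))) f

/-- `vs_{λ/μ}(q,t) = ψ'_{λ/μ}(q,t) = (-1)^{|λ|-|μ|} Q_{λ/μ}((q-1)/(1-t))`. -/
def vsM (q t : F) (P : Partition → Sym F) (lam mu : Partition) : F :=
  (-1 : F) ^ ((lam.size : ℤ) - (mu.size : ℤ)) * plethAB t q 1 (skewQ q t P lam mu)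

/-- `sk_{λ/μ}(q,t) = Q_{λ/μ}((1-q)/(1-t))`. -/
def skM (q t : F) (P : Partition → Sym F) (lam mu : Partition) : F :=
  plethAB t 1 q (skewQ q t P lam mu)

/-- `ŝk_{λ/μ}(q,t) = Q_{λ/μ}((1-q/t)/(1-t))`. -/
def skHatM (q t : F) (P : Partition → Sym F) (lam mu : Partition) : F :=
  plethAB t 1 (q / t) (skewQ q t P lam mu)

/-- `hs_{λ/μ}(q,t) = φ_{λ/μ}(q,t) = Q_{λ/μ}(1)`, the plethystic evaluation
`p_r ↦ 1`. -/
def hsM (q t : F) (P : Partition → Sym F) (lam mu : Partition) : F :=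
  MvPolynomial.eval (fun _ => (1 : F)) (skewQ q t P lam mu)

/-- `ks_{λ/μ}(q,t) = Q_{λ/μ}(-1)`, the plethystic evaluation `p_r ↦ -1`. -/
def ksM (q t : F) (P : Partition → Sym F) (lam mu : Partition) : F :=
  MvPolynomial.eval (fun _ => (-1 : F)) (skewQ q t P lam mu)

/-- the finite `q`-Pochhammer symbol `(a;q)_k = ∏_{j=0}^{k-1}(1 - a q^j)`. -/
def qPochN (qq a : F) (k : ℕ) : F := ∏ j ∈ Finset.range k, (1 - a * qq ^ j)

/-- the `q`-Pochhammer symbol `(a;q)_k = (a;q)_∞/(a q^k;q)_∞` for `k ∈ ℤ`;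
for `k = -m < 0` it equals `1/∏_{i=1}^m (1 - a q^{-i})`. -/
def qPochZ (qq a : F) (k : ℤ) : F :=
  if 0 ≤ k then qPochN qq a k.toNat
  else (∏ j ∈ Finset.range (-k).toNat, (1 - a * (qq⁻¹) ^ (j + 1)))⁻¹

/-- `(a)_λ = (a;q,t)_λ = ∏_{i ≥ 1} (a t^{1-i}; q)_{λ_i}`. -/
def qtPoch (qq tt a : F) (lam : Partition) : F :=
  ∏ j ∈ lam.part.support, qPochN qq (a * tt ^ (-(j : ℤ))) (lam.part j)

/-- the degree (as a symmetric function) of a power-sum exponent vector. -/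
def wt (d : ℕ →₀ ℕ) : ℕ := d.sum fun n m => (n + 1) * m

/-- the degree-`r` homogeneous component of `∏_x (bx;q)_∞/(ax;q)_∞`, namely
`∑_{|κ| = r} z_κ⁻¹ ∏_i (a^{κ_i} - b^{κ_i})/(1 - q^{κ_i}) · p_κ`. -/
def prodComp (a b qq : F) (r : ℕ) : Sym F :=
  ∑ᶠ (k : Partition) (_ : k.size = r),
    ((k.zee : F)⁻¹ *
        ∏ j ∈ k.part.support,
          (a ^ k.part j - b ^ k.part j) / (1 - qq ^ k.part j)) • (pprod k : Sym F)

/-- `∏_x (bx;q)_∞/(ax;q)_∞`, where `(cx;q)_∞ = ∏_{j ≥ 0}(1 - cx q^j)`, as a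
formal power series in the power sums. -/
def prodSeries (a b qq : F) : MvPowerSeries ℕ F :=
  fun d => MvPolynomial.coeff d (prodComp a b qq (wt d))

/-- the formal (possibly infinite) sum `∑_i c_i g_i` of symmetric functions,
as a formal power series in the power sums. -/
def sumSeries {ι : Type*} (c : ι → F) (g : ι → Sym F) : MvPowerSeries ℕ F :=
  fun d => ∑ᶠ i : ι, c i * MvPolynomial.coeff d (g i)

/-- `ℚ(t)` -/
abbrev F1 : Type := RatFunc ℚ
/-- `ℚ(t)(q)` -/
abbrev F2 : Type := RatFunc F1
/-- `ℚ(t)(q)(a)` -/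
abbrev F3 : Type := RatFunc F2
/-- `ℚ(t)(q)(a)(b)` -/
abbrev F4 : Type := RatFunc F3

instance : Field F2 := inferInstance
instance : Field F3 := inferInstance
instance : Field F4 := inferInstance

/-- the indeterminate `t` in `ℚ(t)`. -/
def t1 : F1 := RatFunc.X
/-- the indeterminate `q` in `ℚ(t)(q)`. -/
def q2 : F2 := RatFunc.X
/-- the indeterminate `t` in `ℚ(t)(q)`. -/
def t2 : F2 := RatFunc.C t1
/-- the indeterminate `a` in `ℚ(t)(q)(a)`. -/
def a3 : F3 := RatFunc.X
/-- the indeterminate `q` in `ℚ(t)(q)(a)`. -/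
def q3 : F3 := RatFunc.C q2
/-- the indeterminate `t` in `ℚ(t)(q)(a)`. -/
def t3 : F3 := RatFunc.C t2
/-- the indeterminate `b` in `ℚ(t)(q)(a)(b)`. -/
def b4 : F4 := RatFunc.X
/-- the indeterminate `a` in `ℚ(t)(q)(a)(b)`. -/
def a4 : F4 := RatFunc.C a3
/-- the indeterminate `q` in `ℚ(t)(q)(a)(b)`. -/
def q4 : F4 := RatFunc.C q3
/-- the indeterminate `t` in `ℚ(t)(q)(a)(b)`. -/
def t4 : F4 := RatFunc.C t3


section Helpers

/-- Gaussian binomial with natural number arguments. -/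
def gb (t : F) (n k : ℕ) : F :=
  if k ≤ n then qfac t n / (qfac t k * qfac t (n - k)) else 0

lemma qbinom_eq_gb (t : F) (n k : ℕ) (a b : ℤ) (ha : a = n) (hb : b = k) :
    qbinom t a b = gb t n k := by
  subst ha hb
  unfold qbinom gb
  by_cases h : k ≤ n
  · rw [if_pos ⟨by omega, by omega⟩, if_pos h]
    congr 3
    omega
  · rw [if_neg (by omega), if_neg h]

lemma qint_succ' (t : F) (a b : ℕ) : qint t (a + b) = qint t a + t ^ a * qint t b := by
  unfold qint
  rw [Finset.sum_range_add, Finset.mul_sum]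
  simp [pow_add]

lemma qfac_succ (t : F) (n : ℕ) : qfac t (n + 1) = qfac t n * qint t (n + 1) := by
  unfold qfac
  rw [Finset.prod_range_succ]

lemma qfac_zero (t : F) : qfac t 0 = 1 := by simp [qfac]

lemma qfac_ne (t : F) (ht : ∀ n, qint t (n + 1) ≠ 0) (n : ℕ) : qfac t n ≠ 0 := by
  unfold qfac
  exact Finset.prod_ne_zero_iff.2 fun i _ => ht i

lemma gb_of_lt (t : F) {n k : ℕ} (h : n < k) : gb t n k = 0 := by
  unfold gb
  rw [if_neg (by omega)]

lemma gb_add (t : F) (a b : ℕ) : gb t (a + b) a = qfac t (a + b) / (qfac t a * qfac t b) := by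
  unfold gb
  rw [if_pos (by omega), Nat.add_sub_cancel_left]

lemma gb_zero (t : F) (ht : ∀ n, qint t (n + 1) ≠ 0) (n : ℕ) : gb t n 0 = 1 := by
  have := qfac_ne t ht n
  unfold gb
  simp [qfac_zero, this]

lemma gb_self (t : F) (ht : ∀ n, qint t (n + 1) ≠ 0) (n : ℕ) : gb t n n = 1 := by
  have := qfac_ne t ht n
  unfold gb
  simp [qfac_zero, this]

lemma gb_one (t : F) (ht : ∀ n, qint t (n + 1) ≠ 0) (n : ℕ) : gb t n 1 = qint t n := by
  cases n with
  | zero => simp [gb, qint]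
  | succ n =>
    have := qfac_ne t ht n
    have h1 : qfac t 1 = 1 := by simp [qfac, qint]
    rw [add_comm n 1, gb_add, add_comm 1 n, qfac_succ, h1]
    field_simp

lemma gb_pascal1 (t : F) (ht : ∀ n, qint t (n + 1) ≠ 0) (n r : ℕ) :
    gb t (n + 1) (r + 1) = t ^ (r + 1) * gb t n (r + 1) + gb t n r := by
  rcases lt_trichotomy n r with h | h | h
  · rw [gb_of_lt t (by omega), gb_of_lt t (by omega), gb_of_lt t (by omega)]; simp
  · subst h
    rw [gb_self t ht, gb_self t ht, gb_of_lt t (by omega)]; simp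
  · obtain ⟨c, rfl⟩ : ∃ c, n = r + 1 + c := ⟨n - (r + 1), by omega⟩
    have e1 : gb t (r + 1 + c + 1) (r + 1) = gb t (r + 1 + (c + 1)) (r + 1) := rfl
    have e2 : gb t (r + 1 + c) r = gb t (r + (c + 1)) r := by congr 1; omega
    have e3 : qfac t (r + 1 + (c + 1)) = qfac t (r + 1 + c) * qint t (r + 1 + (c + 1)) :=
      qfac_succ t _
    have e4 : qfac t (r + (c + 1)) = qfac t (r + 1 + c) := by congr 1; omega
    rw [e1, e2, gb_add, gb_add, gb_add, e3, e4, qfac_succ t c, qfac_succ t r, qint_succ' t (r + 1)]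
    have := qfac_ne t ht r
    have := qfac_ne t ht c
    have := ht r
    have := ht c
    field_simp
    ring

lemma gb_pascal2 (t : F) (ht : ∀ n, qint t (n + 1) ≠ 0) (b r : ℕ) :
    gb t (b + (r + 1)) (r + 1) = gb t (b + r) (r + 1) + t ^ b * gb t (b + r) r := by
  cases b with
  | zero => simp [gb_self t ht, gb_of_lt]
  | succ c =>
    have e1 : gb t (c + 1 + (r + 1)) (r + 1) = gb t (r + 1 + (c + 1)) (r + 1) := by
      congr 1; omega
    have e2 : gb t (c + 1 + r) r = gb t (r + (c + 1)) r := by congr 1; omega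
    have e2' : gb t (c + 1 + r) (r + 1) = gb t (r + 1 + c) (r + 1) := by congr 1; omega
    have e3 : qfac t (r + 1 + (c + 1)) = qfac t (r + 1 + c) * qint t (c + 1 + (r + 1)) := by
      rw [add_comm (c + 1)]
      exact qfac_succ t _
    have e4 : qfac t (r + (c + 1)) = qfac t (r + 1 + c) := by congr 1; omega
    rw [e1, e2, e2', gb_add, gb_add, gb_add, e3, e4, qfac_succ t c, qfac_succ t r,
      qint_succ' t (c + 1)]
    have := qfac_ne t ht r
    have := qfac_ne t ht c
    have := ht r
    have := ht c
    field_simp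

lemma gb_tri (t : F) (ht : ∀ n, qint t (n + 1) ≠ 0) (N k r : ℕ) :
    gb t N k * gb t (N - k) r = gb t N (k + r) * gb t (k + r) r := by
  by_cases h : k + r ≤ N
  · obtain ⟨c, rfl⟩ := Nat.exists_eq_add_of_le h
    have e1 : gb t (k + r + c) k = gb t (k + (r + c)) k := by congr 1; omega
    have e2 : k + r + c - k = r + c := by omega
    have e3 : gb t (k + r) r = gb t (r + k) r := by congr 1; omega
    rw [e1, e2, e3, gb_add, gb_add, gb_add, gb_add]
    have e4 : qfac t (k + (r + c)) = qfac t (k + r + c) := by congr 1; omega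
    have e5 : qfac t (r + k) = qfac t (k + r) := by congr 1; omega
    rw [e4, e5]
    have := qfac_ne t ht r
    have := qfac_ne t ht c
    have := qfac_ne t ht k
    have := qfac_ne t ht (k + r)
    have := qfac_ne t ht (r + c)
    field_simp
  · rw [gb_of_lt t (show N < k + r by omega)]
    by_cases h2 : N < k
    · rw [gb_of_lt t h2]; simp
    · rw [gb_of_lt t (show N - k < r by omega)]; simp

/-- the `q`-binomial sum -/
def qsum (t : F) (d : ℕ) (x y : F) : F :=
  ∑ r ∈ Finset.range (d + 1), gb t d r * t ^ (r.choose 2) * y ^ r * x ^ (d - r)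

lemma qsum_succ (t : F) (ht : ∀ n, qint t (n + 1) ≠ 0) (d : ℕ) (x y : F) :
    qsum t (d + 1) x y = (x + y) * qsum t d x (t * y) := by
  have h1 : x * qsum t d x (t * y) =
      (∑ r ∈ Finset.range (d + 1), t ^ (r + 1) * gb t d (r + 1) * t ^ ((r + 1).choose 2) *
        y ^ (r + 1) * x ^ (d - r)) + x ^ (d + 1) := by
    unfold qsum
    rw [Finset.sum_range_succ', mul_add, Finset.mul_sum]
    congr 1
    · rw [Finset.sum_range_succ, gb_of_lt t (show d < d + 1 by omega)]
      simp only [mul_zero, zero_mul, add_zero]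
      refine Finset.sum_congr rfl fun r hr => ?_
      have hr' := Finset.mem_range.1 hr
      have : d - r = (d - (r + 1)) + 1 := by omega
      rw [this, pow_succ x, mul_pow]
      ring
    · simp [gb_zero t ht]
      ring
  have h2 : y * qsum t d x (t * y) =
      ∑ r ∈ Finset.range (d + 1), gb t d r * t ^ ((r + 1).choose 2) *
        y ^ (r + 1) * x ^ (d - r) := by
    unfold qsum
    rw [Finset.mul_sum]
    refine Finset.sum_congr rfl fun r _ => ?_
    rw [Nat.choose_succ_succ' r 1, Nat.choose_one_right, pow_add, mul_pow]
    ring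
  rw [add_mul, h1, h2]
  unfold qsum
  rw [Finset.sum_range_succ', add_right_comm, ← Finset.sum_add_distrib]
  congr 1
  · refine Finset.sum_congr rfl fun r _ => ?_
    rw [gb_pascal1 t ht, Nat.add_sub_add_right]
    ring
  · simp [gb_zero t ht]

lemma qsum_t_zero (t : F) (ht : ∀ n, qint t (n + 1) ≠ 0) (d : ℕ) :
    qsum t (d + 1) (-t) t = 0 := by
  rw [qsum_succ t ht]; simp

lemma qsum_one_zero (t : F) (ht : ∀ n, qint t (n + 1) ≠ 0) (d : ℕ) :
    qsum t (d + 2) (-t) 1 = 0 := by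
  rw [qsum_succ t ht, mul_one, qsum_t_zero t ht, mul_zero]

/-- local sum, by the variable `r = m - n`, `k = d - r`. -/
def lsum (t : F) (a b d : ℕ) : F :=
  ∑ r ∈ Finset.range (d + 1),
    (-t) ^ (d - r) * gb t a (d - r) * t ^ (r.choose 2) * gb t (b + r) r

lemma lsum_zero (t : F) (ht : ∀ n, qint t (n + 1) ≠ 0) (a b : ℕ) : lsum t a b 0 = 1 := by
  simp [lsum, gb_zero t ht]

lemma lsum_one_a (t : F) (ht : ∀ n, qint t (n + 1) ≠ 0) (b : ℕ) :
    lsum t (b + 1) b 1 = 1 - t ^ (b + 1) := by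
  simp only [lsum, Finset.sum_range_succ, Finset.sum_range_zero, Nat.sub_zero, Nat.sub_self,
    gb_zero t ht, gb_one t ht, Nat.choose_zero_succ, pow_zero, pow_one]
  have : qint t (b + 1) * (t - 1) = t ^ (b + 1) - 1 := by
    unfold qint; exact geom_sum_mul t (b + 1)
  simp
  linear_combination -this

lemma lsum_one_b (t : F) (ht : ∀ n, qint t (n + 1) ≠ 0) (b : ℕ) :
    lsum t b b 1 = 1 := by
  simp only [lsum, Finset.sum_range_succ, Finset.sum_range_zero, Nat.sub_zero, Nat.sub_self,
    gb_zero t ht, gb_one t ht, Nat.choose_zero_succ, pow_zero, pow_one]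
  have : qint t (b + 1) = 1 + t * qint t b := by
    rw [add_comm, qint_succ']; simp [qint]
  simp [this]

lemma lsum_two_a (t : F) (ht : ∀ n, qint t (n + 1) ≠ 0) (b d : ℕ) :
    lsum t (b + (d + 2)) b (d + 2) = 0 := by
  have : lsum t (b + (d + 2)) b (d + 2) = gb t (b + (d + 2)) (d + 2) * qsum t (d + 2) (-t) 1 := by
    unfold lsum qsum
    rw [Finset.mul_sum]
    refine Finset.sum_congr rfl fun r hr => ?_
    have hr' := Finset.mem_range.1 hr
    have h := gb_tri t ht (b + (d + 2)) (d + 2 - r) r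
    rw [show b + (d + 2) - (d + 2 - r) = b + r by omega, show d + 2 - r + r = d + 2 by omega] at h
    rw [one_pow]
    linear_combination (-t) ^ (d + 2 - r) * t ^ (r.choose 2) * h
  rw [this, qsum_one_zero t ht, mul_zero]

lemma lsum_two_b (t : F) (ht : ∀ n, qint t (n + 1) ≠ 0) (b d : ℕ) :
    lsum t (b + (d + 1)) b (d + 2) = 0 := by
  have : lsum t (b + (d + 1)) b (d + 2) = gb t (b + (d + 1)) (d + 2) * qsum t (d + 2) (-t) 1
      + t ^ b * gb t (b + (d + 1)) (d + 1) * qsum t (d + 1) (-t) t := by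
    unfold lsum qsum
    rw [Finset.sum_range_succ', Finset.sum_range_succ' _ (d + 2), mul_add, add_right_comm,
      Finset.mul_sum, Finset.mul_sum, ← Finset.sum_add_distrib]
    congr 1
    · refine Finset.sum_congr rfl fun r hr => ?_
      have hr' := Finset.mem_range.1 hr
      have h := gb_tri t ht (b + (d + 1)) (d + 1 - r) (r + 1)
      have h' := gb_tri t ht (b + (d + 1)) (d + 1 - r) r
      rw [show b + (d + 1) - (d + 1 - r) = b + r by omega] at h h'
      rw [show d + 1 - r + (r + 1) = d + 2 by omega] at h
      rw [show d + 1 - r + r = d + 1 by omega] at h'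
      rw [show d + 2 - (r + 1) = d + 1 - r by omega, one_pow, gb_pascal2 t ht,
        Nat.choose_succ_succ' r 1, Nat.choose_one_right, pow_add]
      linear_combination (-t) ^ (d + 1 - r) * t ^ r * t ^ (r.choose 2) * h +
        t ^ b * (-t) ^ (d + 1 - r) * t ^ r * t ^ (r.choose 2) * h'
    · simp [gb_zero t ht]
      ring
  rw [this, qsum_one_zero t ht, qsum_t_zero t ht, mul_zero, mul_zero, add_zero]

/-- local factor -/
def lterm (t : F) (l l' n n' m : ℕ) : F :=
  (-t) ^ (l - m) * qbinom t ((l : ℤ) - l') ((l : ℤ) - m) *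
    (t ^ ((m - n).choose 2) * qbinom t ((m : ℤ) - n') ((m : ℤ) - n))

lemma lterm_sum (t : F) (l l' n n' : ℕ) (h1 : l' ≤ l) (h2 : n' ≤ n)
    (h4 : n ≤ l) :
    ∑ m ∈ Finset.Icc l' l, lterm t l l' n n' m = lsum t (l - l') (n - n') (l - n) := by
  have e1 : ∑ m ∈ Finset.Icc l' l, lterm t l l' n n' m =
      ∑ m ∈ Finset.range (l + 1), lterm t l l' n n' m := by
    refine Finset.sum_subset (fun m hm => ?_) (fun m hm hm' => ?_)
    · simp at hm ⊢; omega
    · simp at hm hm'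
      unfold lterm qbinom
      rw [if_neg (show ¬ (0 ≤ (l : ℤ) - m ∧ (l : ℤ) - m ≤ (l : ℤ) - l') by omega)]
      simp
  rw [e1, show l + 1 = n + (l - n + 1) by omega, Finset.sum_range_add, Finset.sum_eq_zero, zero_add]
  · unfold lsum
    refine Finset.sum_congr rfl fun r hr => ?_
    have hr' := Finset.mem_range.1 hr
    unfold lterm
    rw [qbinom_eq_gb t (l - l') (l - n - r) _ _ (by omega) (by push_cast; omega),
      qbinom_eq_gb t (n - n' + r) r _ _ (by push_cast; omega) (by push_cast; omega),
      show l - (n + r) = l - n - r by omega, show n + r - n = r by omega]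
    ring
  · intro m hm
    have hm := Finset.mem_range.1 hm
    unfold lterm
    rw [show qbinom t ((m : ℤ) - n') ((m : ℤ) - n) = 0 by
      unfold qbinom; rw [if_neg (by omega)]]
    simp

lemma lterm_sum_zero (t : F) (ht : ∀ n, qint t (n + 1) ≠ 0) (l l' n n' : ℕ)
    (h1 : l' ≤ l) (h2 : n' ≤ n) (h5 : n' ≤ l') (h6 : l' ≤ n' + 1) (h4 : n + 2 ≤ l) :
    ∑ m ∈ Finset.Icc l' l, lterm t l l' n n' m = 0 := by
  rw [lterm_sum t l l' n n' h1 h2 (by omega)]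
  obtain ⟨d, hd⟩ : ∃ d, l - n = d + 2 := ⟨l - n - 2, by omega⟩
  rw [hd]
  rcases (show l' = n' ∨ l' = n' + 1 by omega) with h | h
  · rw [show l - l' = n - n' + (d + 2) by omega]
    exact lsum_two_a t ht _ _
  · rw [show l - l' = n - n' + (d + 1) by omega]
    exact lsum_two_b t ht _ _

lemma lterm_sum_good (t : F) (ht : ∀ n, qint t (n + 1) ≠ 0) (l l' n n' : ℕ)
    (h1 : l' ≤ l) (h2 : n' ≤ n) (h5 : n' ≤ l') (h6 : l' ≤ n' + 1) (h4 : n ≤ l) (h7 : l ≤ n + 1) :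
    ∑ m ∈ Finset.Icc l' l, lterm t l l' n n' m =
      if l = n + 1 ∧ l' = n' then 1 - t ^ (l - l') else 1 := by
  rw [lterm_sum t l l' n n' h1 h2 (by omega)]
  rcases (show l = n ∨ l = n + 1 by omega) with h | h
  · rw [if_neg (by omega), show l - n = 0 by omega, lsum_zero t ht]
  · rw [show l - n = 1 by omega]
    rcases (show l' = n' ∨ l' = n' + 1 by omega) with h' | h'
    · rw [if_pos ⟨h, h'⟩, show l - l' = n - n' + 1 by omega]
      exact lsum_one_a t ht _
    · rw [if_neg (by omega), show l - l' = n - n' by omega]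
      exact lsum_one_b t ht _

lemma qint_t1_ne (n : ℕ) : qint t1 (n + 1) ≠ 0 := by
  unfold qint t1
  have : (∑ j ∈ Finset.range (n + 1), (RatFunc.X : RatFunc ℚ) ^ j) =
      algebraMap (Polynomial ℚ) (RatFunc ℚ) (∑ j ∈ Finset.range (n + 1), Polynomial.X ^ j) := by
    simp
  rw [this]
  refine RatFunc.algebraMap_ne_zero fun h => ?_
  have h2 := congrArg (Polynomial.eval 1) h
  simp [Polynomial.eval_finsetSum] at h2
  norm_cast at h2

lemma lt_conj (mu : Partition) (i j : ℕ) : j < mu.conj (i + 1) ↔ i < mu.part j := by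
  unfold Partition.conj
  constructor
  · intro h
    by_contra hc
    have hs : (mu.part.support.filter fun j => i + 1 ≤ mu.part j) ⊆ Finset.range j := by
      intro k hk
      have hk := (Finset.mem_filter.1 hk).2
      rw [Finset.mem_range]
      by_contra hkj
      have := mu.antitone' (show j ≤ k by omega)
      omega
    have := Finset.card_le_card hs
    rw [Finset.card_range] at this
    omega
  · intro h
    have hs : Finset.range (j + 1) ⊆ (mu.part.support.filter fun j => i + 1 ≤ mu.part j) := by
      intro k hk
      have hk := Finset.mem_range.1 hk
      have := mu.antitone' (show k ≤ j by omega)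
      rw [Finset.mem_filter, Finsupp.mem_support_iff]
      omega
    have := Finset.card_le_card hs
    rw [Finset.card_range] at this
    omega

lemma part_ext (a b : Partition) (h : ∀ i, a.conj (i + 1) = b.conj (i + 1)) : a = b := by
  have hp : a.part = b.part := by
    ext j
    refine eq_of_forall_lt_iff fun i => ?_
    rw [← lt_conj, ← lt_conj, h]
  cases a; cases b; simp_all

lemma le_iff_conj (a b : Partition) : a ≤ b ↔ ∀ i, a.conj (i + 1) ≤ b.conj (i + 1) := by
  constructor
  · intro h i
    refine le_of_forall_lt fun j hj => ?_
    rw [lt_conj] at hj ⊢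
    exact lt_of_lt_of_le hj (h j)
  · intro h j
    refine le_of_forall_lt fun i hi => ?_
    rw [← lt_conj] at hi ⊢
    exact lt_of_lt_of_le hi (h i)

lemma conj_anti (a : Partition) (i : ℕ) : a.conj (i + 1) ≤ a.conj i := by
  unfold Partition.conj
  refine Finset.card_le_card fun k hk => ?_
  rw [Finset.mem_filter] at hk ⊢
  exact ⟨hk.1, by omega⟩

lemma conj_zero (a : Partition) : a.conj 0 = a.conj 1 := by
  unfold Partition.conj
  congr 1
  refine Finset.filter_congr fun k hk => ?_
  rw [Finsupp.mem_support_iff] at hk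
  omega

lemma conj_eq_zero (a : Partition) (i : ℕ) (h : a.part 0 ≤ i) : a.conj (i + 1) = 0 := by
  by_contra hc
  have := (lt_conj a i 0).1 (by omega)
  omega

lemma size_eq (a : Partition) (K : ℕ) (h : a.part 0 ≤ K) :
    a.size = ∑ i ∈ Finset.range K, a.conj (i + 1) := by
  unfold Partition.size Partition.conj Finsupp.sum
  simp_rw [Finset.card_filter]
  rw [Finset.sum_comm]
  refine Finset.sum_congr rfl fun j _ => ?_
  rw [← Finset.card_filter]
  have : (Finset.range K).filter (fun i => i + 1 ≤ a.part j) = Finset.range (a.part j) := by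
    ext i
    have := a.antitone' (Nat.zero_le j)
    simp only [Finset.mem_filter, Finset.mem_range]
    omega
  rw [this, Finset.card_range]

/-- the partition with given columns -/
def ofCols {K : ℕ} (x : Fin K → ℕ) : Partition where
  part := Finsupp.onFinset (Finset.range (∑ i, x i))
    (fun j => (Finset.univ.filter fun i => j < x i).card)
    (fun j h => by
      obtain ⟨i, hi⟩ := Finset.card_pos.1 (Nat.pos_of_ne_zero h)
      have hi := (Finset.mem_filter.1 hi).2
      have := Finset.single_le_sum (f := x) (fun _ _ => Nat.zero_le _) (Finset.mem_univ i)
      rw [Finset.mem_range]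
      omega)
  antitone' := by
    intro a b hab
    simp only [Finsupp.onFinset_apply]
    refine Finset.card_le_card fun k hk => ?_
    simp only [Finset.mem_filter, Finset.mem_univ, true_and] at hk ⊢
    omega

lemma conj_ofCols {K : ℕ} (x : Fin K → ℕ) (hx : Antitone x) (i : Fin K) :
    (ofCols x).conj (i + 1) = x i := by
  refine eq_of_forall_lt_iff fun j => ?_
  rw [lt_conj]
  change (i : ℕ) < (Finset.univ.filter fun i => j < x i).card ↔ _
  constructor
  · intro h
    by_contra hc
    have hs : (Finset.univ.filter fun i => j < x i) ⊆ Finset.Iio i := by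
      intro k hk
      have hk := (Finset.mem_filter.1 hk).2
      rw [Finset.mem_Iio]
      by_contra hki
      have := hx (not_lt.1 hki)
      omega
    have := Finset.card_le_card hs
    rw [Fin.card_Iio] at this
    omega
  · intro h
    have hs : Finset.Iic i ⊆ (Finset.univ.filter fun i => j < x i) := by
      intro k hk
      have := hx (Finset.mem_Iic.1 hk)
      simp only [Finset.mem_filter, Finset.mem_univ, true_and]
      omega
    have := Finset.card_le_card hs
    rw [Fin.card_Iic] at this
    omega

lemma conj_ofCols_ge {K : ℕ} (x : Fin K → ℕ) (i : ℕ) (h : K ≤ i) :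
    (ofCols x).conj (i + 1) = 0 := by
  refine conj_eq_zero _ _ (le_trans ?_ h)
  change (Finset.univ.filter fun i => 0 < x i).card ≤ K
  exact (Finset.card_le_univ _).trans (by simp)

lemma prod_Icc_ext {M : Type*} [CommMonoid M] (f : ℕ → M) (N K : ℕ) (h : N ≤ K)
    (hf : ∀ i, N ≤ i → f (i + 1) = 1) :
    ∏ i ∈ Finset.Icc 1 N, f i = ∏ i : Fin K, f (i + 1) := by
  rw [← Finset.prod_range (fun i => f (i + 1))]
  have : ∏ i ∈ Finset.Icc 1 N, f i = ∏ i ∈ Finset.range N, f (i + 1) := by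
    rw [Finset.range_eq_Ico, Finset.prod_Ico_add' f 0 N 1]
    rfl
  rw [this]
  refine Finset.prod_subset (by simpa using h) fun i _ hi => hf i ?_
  simpa using hi

lemma qbinom_zero_zero (t : F) : qbinom t 0 0 = 1 := by
  simp [qbinom, qfac_zero]

lemma term_eq (t : F) (lam mu nu : Partition) (K : ℕ) (hK : K = lam.part 0 + lam.part 0)
    (h1 : nu ≤ mu) (h2 : mu ≤ lam) :
    (-t) ^ (lam.size - mu.size) * vsHL t lam mu * skHL t mu nu =
      ∏ i : Fin K, lterm t (lam.conj (i + 1)) (lam.conj (i + 1 + 1)) (nu.conj (i + 1))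
        (nu.conj (i + 1 + 1)) (mu.conj (i + 1)) := by
  have a1 := h1 0
  have a2 := h2 0
  have hs : lam.size - mu.size = ∑ i : Fin K, (lam.conj (i + 1) - mu.conj (i + 1)) := by
    rw [size_eq lam K (by omega), size_eq mu K (by omega), Finset.sum_range, Finset.sum_range,
      Finset.sum_tsub_distrib]
    intro i _
    exact (le_iff_conj _ _).1 h2 i
  have hv : vsHL t lam mu = ∏ i : Fin K, qbinom t ((lam.conj (i + 1) : ℤ) - lam.conj (i + 1 + 1))
      ((lam.conj (i + 1) : ℤ) - mu.conj (i + 1)) := by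
    unfold vsHL
    rw [prod_Icc_ext _ _ K (by omega)]
    intro i hi
    rw [conj_eq_zero lam i (by omega), conj_eq_zero lam (i + 1) (by omega),
      conj_eq_zero mu i (by omega)]
    simp [qbinom_zero_zero]
  have hn : t ^ nskew mu nu = ∏ i : Fin K, t ^ ((mu.conj (i + 1) - nu.conj (i + 1)).choose 2) := by
    unfold nskew
    rw [← Finset.prod_pow_eq_pow_sum, prod_Icc_ext _ _ K (by omega)]
    intro i hi
    rw [conj_eq_zero mu i (by omega)]
    simp
  have hk : (∏ i ∈ Finset.Icc 1 (mu.part 0 + nu.part 0),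
      qbinom t ((mu.conj i : ℤ) - nu.conj (i + 1)) ((mu.conj i : ℤ) - nu.conj i)) =
      ∏ i : Fin K, qbinom t ((mu.conj (i + 1) : ℤ) - nu.conj (i + 1 + 1))
      ((mu.conj (i + 1) : ℤ) - nu.conj (i + 1)) := by
    rw [prod_Icc_ext _ _ K (by omega)]
    intro i hi
    rw [conj_eq_zero mu i (by omega), conj_eq_zero nu (i + 1) (by omega),
      conj_eq_zero nu i (by omega)]
    simp [qbinom_zero_zero]
  unfold skHL
  rw [hs, hv, hn, hk, ← Finset.prod_pow_eq_pow_sum, ← Finset.prod_mul_distrib,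
    ← Finset.prod_mul_distrib, ← Finset.prod_mul_distrib]
  rfl

lemma lterm_ne (t : F) (l l' n n' m : ℕ) (h : lterm t l l' n n' m ≠ 0) :
    l' ≤ m ∧ m ≤ l ∧ n ≤ m := by
  unfold lterm at h
  have h1 := right_ne_zero_of_mul (left_ne_zero_of_mul h)
  have h2 := right_ne_zero_of_mul (right_ne_zero_of_mul h)
  unfold qbinom at h1 h2
  have h1 := (ite_ne_right_iff.1 h1).1
  have h2 := (ite_ne_right_iff.1 h2).1
  omega

lemma sum_eq_prod (t : F) (lam nu : Partition) (hle : nu ≤ lam) (K : ℕ)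
    (hK : K = lam.part 0 + lam.part 0) :
    (∑ᶠ (mu : Partition) (_ : nu ≤ mu ∧ mu ≤ lam),
        (-t) ^ (lam.size - mu.size) * vsHL t lam mu * skHL t mu nu) =
    ∏ i : Fin K, ∑ m ∈ Finset.Icc (lam.conj (i + 1 + 1)) (lam.conj (i + 1)),
      lterm t (lam.conj (i + 1)) (lam.conj (i + 1 + 1)) (nu.conj (i + 1))
        (nu.conj (i + 1 + 1)) m := by
  classical
  rw [Finset.prod_univ_sum]
  set X := Fintype.piFinset fun i : Fin K =>
    Finset.Icc (lam.conj (i + 1 + 1)) (lam.conj (i + 1)) with hX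
  have lanti : Antitone lam.conj := antitone_nat_of_succ_le (conj_anti lam)
  have hanti : ∀ x ∈ X, Antitone x := by
    intro x hx i j hij
    rw [hX, Fintype.mem_piFinset] at hx
    rcases hij.eq_or_lt with rfl | hlt
    · exact le_rfl
    · have h1 := Finset.mem_Icc.1 (hx i)
      have h2 := Finset.mem_Icc.1 (hx j)
      have := lanti (show (i : ℕ) + 1 + 1 ≤ j + 1 by
        have : (i : ℕ) < j := hlt
        omega)
      omega
  have hinj : Set.InjOn (ofCols (K := K)) X := by
    intro x hx y hy hxy
    funext i
    rw [← conj_ofCols x (hanti x hx), hxy, conj_ofCols y (hanti y hy)]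
  rw [finsum_eq_sum_of_support_subset (s := X.image ofCols), Finset.sum_image hinj]
  · refine Finset.sum_congr rfl fun x hx => ?_
    have hc := conj_ofCols x (hanti x hx)
    have hle2 : ofCols x ≤ lam := by
      rw [le_iff_conj]
      intro i
      by_cases hi : i < K
      · have := hc ⟨i, hi⟩
        simp only at this
        rw [this]
        rw [hX, Fintype.mem_piFinset] at hx
        exact (Finset.mem_Icc.1 (hx ⟨i, hi⟩)).2
      · rw [conj_ofCols_ge x i (by omega)]
        exact Nat.zero_le _
    rw [finsum_eq_if]
    by_cases hn : nu ≤ ofCols x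
    · rw [if_pos ⟨hn, hle2⟩, term_eq t lam (ofCols x) nu K hK hn hle2]
      refine Finset.prod_congr rfl fun i _ => ?_
      rw [hc i]
    · rw [if_neg (fun h => hn h.1)]
      rw [le_iff_conj] at hn
      push Not at hn
      obtain ⟨i, hi⟩ := hn
      have hiK : i < K := by
        by_contra hc
        have := (le_iff_conj _ _).1 hle i
        rw [conj_eq_zero lam i (by omega)] at this
        omega
      symm
      refine Finset.prod_eq_zero (Finset.mem_univ (⟨i, hiK⟩ : Fin K)) ?_
      by_contra hne
      have h1 := lterm_ne _ _ _ _ _ _ hne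
      rw [← hc ⟨i, hiK⟩] at h1
      simp only at h1
      omega
  · intro mu hmu
    rw [Function.mem_support, finsum_eq_if] at hmu
    obtain ⟨hp, hne⟩ := ite_ne_right_iff.1 hmu
    rw [term_eq t lam mu nu K hK hp.1 hp.2, Finset.prod_ne_zero_iff] at hne
    rw [Finset.mem_coe, Finset.mem_image]
    have hxX : (fun i : Fin K => mu.conj (i + 1)) ∈ X := by
      rw [hX, Fintype.mem_piFinset]
      intro i
      have := lterm_ne _ _ _ _ _ _ (hne i (Finset.mem_univ i))
      exact Finset.mem_Icc.2 ⟨this.1, this.2.1⟩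
    refine ⟨_, hxX, part_ext _ _ fun i => ?_⟩
    by_cases hi : i < K
    · exact conj_ofCols _ (hanti _ hxX) ⟨i, hi⟩
    · have := hp.2 0
      rw [conj_ofCols_ge _ i (by omega), conj_eq_zero mu i (by omega)]

lemma main_general (t : F) (ht : ∀ n, qint t (n + 1) ≠ 0) (lam nu : Partition) :
    (∑ᶠ (mu : Partition) (_ : nu ≤ mu ∧ mu ≤ lam),
        (-t) ^ (lam.size - mu.size) * vsHL t lam mu * skHL t mu nu) =
      hsHL t lam nu := by
  classical
  by_cases hle : nu ≤ lam
  · rw [sum_eq_prod t lam nu hle _ rfl]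
    have hc := (le_iff_conj _ _).1 hle
    have h0 := hle 0
    unfold hsHL
    split_ifs with h
    · rw [prod_Icc_ext _ _ (lam.part 0 + lam.part 0) (by omega)]
      · refine Finset.prod_congr rfl fun i _ => ?_
        exact lterm_sum_good t ht _ _ _ _ (conj_anti _ _) (conj_anti _ _) (h _).1 (h _).2
          (h _).1 (h _).2
      · intro i hi
        rw [conj_eq_zero lam i (by omega)]
        simp
    · have hex : ∃ i, nu.conj (i + 1) + 2 ≤ lam.conj (i + 1) := by
        by_contra hno
        push Not at hno
        refine h fun i => ?_
        cases i with
        | zero =>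
          rw [conj_zero, conj_zero]
          have := hno 0
          have := hc 0
          simp only [zero_add] at *
          omega
        | succ i =>
          have := hno i
          have := hc i
          omega
      have hb : ∀ i, nu.conj (i + 1) + 2 ≤ lam.conj (i + 1) → i ≤ lam.part 0 := by
        intro i hi
        by_contra hcon
        rw [conj_eq_zero lam i (by omega)] at hi
        omega
      obtain ⟨i0, hi0⟩ := hex
      have hg := Nat.findGreatest_spec (P := fun i => nu.conj (i + 1) + 2 ≤ lam.conj (i + 1))
        (hb i0 hi0) hi0
      set g := Nat.findGreatest (fun i => nu.conj (i + 1) + 2 ≤ lam.conj (i + 1)) (lam.part 0)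
        with hgdef
      have hnext : ¬ (nu.conj (g + 1 + 1) + 2 ≤ lam.conj (g + 1 + 1)) := by
        intro hcon
        have := Nat.le_findGreatest
          (P := fun i => nu.conj (i + 1) + 2 ≤ lam.conj (i + 1)) (hb _ hcon) hcon
        omega
      have hnext' : lam.conj (g + 1 + 1) ≤ nu.conj (g + 1 + 1) + 1 := by omega
      have hgK : g < lam.part 0 + lam.part 0 := by
        by_contra hcon
        rw [conj_eq_zero lam g (by omega)] at hg
        omega
      refine Finset.prod_eq_zero (Finset.mem_univ (⟨g, hgK⟩ : Fin _)) ?_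
      exact lterm_sum_zero t ht _ _ _ _ (conj_anti _ _) (conj_anti _ _) (hc _) hnext' hg
  · have hz : hsHL t lam nu = 0 := by
      unfold hsHL
      rw [if_neg]
      intro h
      exact hle ((le_iff_conj _ _).2 fun i => (h _).1)
    rw [hz]
    refine finsum_eq_zero_of_forall_eq_zero fun mu => ?_
    rw [finsum_eq_if, if_neg]
    rintro ⟨h1, h2⟩
    exact hle fun j => (h1 j).trans (h2 j)

end Helpers

/-- Konvalinka--Lauve's Lemma 5 (Hall--Littlewood case): for
all partitions `λ, ν`,
`∑_μ (-t)^{|λ|-|μ|} vs_{λ/μ}(t) sk_{μ/ν}(t) = hs_{λ/ν}(t)`,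
the sum over partitions `μ` with `ν ⊆ μ ⊆ λ`. -/
theorem vs_sk_sum_hall_littlewood (lam nu : Partition) :
    (∑ᶠ (mu : Partition) (_ : nu ≤ mu ∧ mu ≤ lam),
        (-t1) ^ (lam.size - mu.size) * vsHL t1 lam mu * skHL t1 mu nu) =
      hsHL t1 lam nu := by
  exact main_general t1 qint_t1_ne lam nu

end SkewPieriFormalization
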